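/- arXiv:1603.02791 — 3 statements merged into one kernel-verified Lean document; each statement's English description precedes it below -/
import Mathlib

section
/- Fix m ∈ {1,…,K−1}, a threshold c > 0, and a subset A ⊆ [K] with |A| = m. Under the singularity assumption on each stream, the gap rule stopping time is almost surely finite under P_A, i.e. P_A(T_G < ∞) = 1, and its error probability satisfies P_A(d_G ≠ A) ≤ m(K−m)e^{−c}. -/
open MeasureTheory ProbabilityTheory Filter Set
open scoped ENNReal NNReal Topology Classical

noncomputable section

namespace SeqMT

variable {Ω : Type*}

/-- The `m`-th largest value (1-indexed, for `1 ≤ m ≤ K`) among `v 0, …, v (K-1)`. -/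
noncomputable def orderStat {K : ℕ} (v : Fin K → ℝ) (m : ℕ) : ℝ :=
  ((Finset.univ.val.map v).sort (· ≤ ·)).getD (K - m) 0

/-- The number of strictly positive entries of `v`. -/
noncomputable def posCount {K : ℕ} (v : Fin K → ℝ) : ℕ :=
  (Finset.univ.filter fun k => 0 < v k).card

/-- The rank (0-indexed) of stream `k`, ordering by value (descending) with ties broken
by stream index: `rankOf v k = r` means `k = i_{r+1}`. -/
noncomputable def rankOf {K : ℕ} (v : Fin K → ℝ) (k : Fin K) : ℕ :=
  (Finset.univ.filter fun j => v k < v j ∨ (v j = v k ∧ j < k)).card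

/-- The set `{i_1, …, i_m}` of the `m` streams with the largest values. -/
noncomputable def topSet {K : ℕ} (v : Fin K → ℝ) (m : ℕ) : Finset (Fin K) :=
  Finset.univ.filter fun k => rankOf v k < m

/-- First time `n ≥ 1` at which `Q n` holds (`⊤` if it never does). -/
noncomputable def stopTime (Q : ℕ → Ω → Prop) (ω : Ω) : ℕ∞ :=
  sInf {n : ℕ∞ | ∃ m : ℕ, n = (m : ℕ∞) ∧ 1 ≤ m ∧ Q m ω}

/-- The log-likelihood ratio process `λ^{A,C}` of `P_A` versus `P_C`. -/
def llrAC {K : ℕ} (lam : Fin K → ℕ → Ω → ℝ) (A C : Finset (Fin K)) (n : ℕ) (ω : Ω) : ℝ :=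
  ∑ k ∈ A \ C, lam k n ω - ∑ k ∈ C \ A, lam k n ω

/-- The gap rule stopping time `T_G`. -/
noncomputable def gapTime {K : ℕ} (lam : Fin K → ℕ → Ω → ℝ) (m : ℕ) (c : ℝ) : Ω → ℕ∞ :=
  stopTime fun n ω =>
    c ≤ orderStat (fun k => lam k n ω) m - orderStat (fun k => lam k n ω) (m + 1)

/-- The gap rule decision `d_G = {i_1(T_G), …, i_m(T_G)}`. -/
noncomputable def gapDecision {K : ℕ} (lam : Fin K → ℕ → Ω → ℝ) (m : ℕ) (c : ℝ)
    (ω : Ω) : Finset (Fin K) :=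
  topSet (fun k => lam k (gapTime lam m c ω).toNat ω) m

/-- `τ₁` (with the convention `λ^{(0)} = -∞`, so `τ₁ = ∞` when `ℓ = 0`). -/
noncomputable def tau1 {K : ℕ} (lam : Fin K → ℕ → Ω → ℝ) (ℓ : ℕ) (a c : ℝ) : Ω → ℕ∞ :=
  stopTime fun n ω => 1 ≤ ℓ ∧ orderStat (fun k => lam k n ω) (ℓ + 1) ≤ -a ∧
    c ≤ orderStat (fun k => lam k n ω) ℓ - orderStat (fun k => lam k n ω) (ℓ + 1)

/-- `τ₂`. -/
noncomputable def tau2 {K : ℕ} (lam : Fin K → ℕ → Ω → ℝ) (ℓ u : ℕ) (a b : ℝ) : Ω → ℕ∞ :=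
  stopTime fun n ω => ℓ ≤ posCount (fun k => lam k n ω) ∧ posCount (fun k => lam k n ω) ≤ u ∧
    ∀ k : Fin K, lam k n ω ∉ Set.Ioo (-a) b

/-- `τ₃` (with the convention `λ^{(K+1)} = ∞`, so `τ₃ = ∞` when `u = K`). -/
noncomputable def tau3 {K : ℕ} (lam : Fin K → ℕ → Ω → ℝ) (u : ℕ) (b d : ℝ) : Ω → ℕ∞ :=
  stopTime fun n ω => u < K ∧ b ≤ orderStat (fun k => lam k n ω) u ∧
    d ≤ orderStat (fun k => lam k n ω) u - orderStat (fun k => lam k n ω) (u + 1)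

/-- The gap-intersection stopping time `T_GI = min{τ₁, τ₂, τ₃}`. -/
noncomputable def giTime {K : ℕ} (lam : Fin K → ℕ → Ω → ℝ) (ℓ u : ℕ) (a b c d : ℝ) :
    Ω → ℕ∞ := fun ω =>
  min (tau1 lam ℓ a c ω) (min (tau2 lam ℓ u a b ω) (tau3 lam u b d ω))

/-- The gap-intersection decision `d_GI = {i_1(T_GI), …, i_{p'}(T_GI)}`,
`p' = min(max(p(T_GI), ℓ), u)`. -/
noncomputable def giDecision {K : ℕ} (lam : Fin K → ℕ → Ω → ℝ) (ℓ u : ℕ) (a b c d : ℝ)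
    (ω : Ω) : Finset (Fin K) :=
  topSet (fun k => lam k (giTime lam ℓ u a b c d ω).toNat ω)
    (min (max (posCount (fun k => lam k (giTime lam ℓ u a b c d ω).toNat ω)) ℓ) u)

/-- The intersection rule stopping time `T_I`. -/
noncomputable def interTime {K : ℕ} (lam : Fin K → ℕ → Ω → ℝ) (a b : ℝ) : Ω → ℕ∞ :=
  stopTime fun n ω => ∀ k : Fin K, lam k n ω ∉ Set.Ioo (-a) b

/-- The intersection rule decision `d_I`: streams with positive LLR at `T_I`. -/
noncomputable def interDecision {K : ℕ} (lam : Fin K → ℕ → Ω → ℝ) (a b : ℝ)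
    (ω : Ω) : Finset (Fin K) :=
  Finset.univ.filter fun k => 0 < lam k (interTime lam a b ω).toNat ω

/-- `φ(x,y) = x log(x/(1-y)) + (1-x) log((1-x)/y)`. -/
noncomputable def phi (x y : ℝ) : ℝ :=
  x * Real.log (x / (1 - y)) + (1 - x) * Real.log ((1 - x) / y)

/-- `γ_{A,C}(α,β)`. -/
noncomputable def gammaAC {K : ℕ} (A C : Finset (Fin K)) (α β : ℝ) : ℝ :=
  if (C \ A).Nonempty ∧ A \ C = ∅ then phi α β
  else if C \ A = ∅ ∧ (A \ C).Nonempty then phi β α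
  else max (phi α β) (phi β α)

/-- `min_{k ∈ S} D k`, as an extended nonnegative real (so `= ∞` when `S = ∅`). -/
noncomputable def eta {K : ℕ} (S : Finset (Fin K)) (D : Fin K → ℝ) : ℝ≥0∞ :=
  S.inf fun k => ENNReal.ofReal (D k)

/-- `T` is a stopping time of the filtration `F`. -/
def IsST (F : ℕ → MeasurableSpace Ω) (T : Ω → ℕ∞) : Prop :=
  ∀ n : ℕ, MeasurableSet[F n] {ω | T ω ≤ (n : ℕ∞)}

/-- `d` is an `F_T`-measurable decision. -/
def IsDecision {K : ℕ} (F : ℕ → MeasurableSpace Ω) (T : Ω → ℕ∞)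
    (d : Ω → Finset (Fin K)) : Prop :=
  ∀ (n : ℕ) (B : Finset (Fin K)), MeasurableSet[F n] {ω | d ω = B ∧ T ω = (n : ℕ∞)}

/-- `(T,d) ∈ Δ_{α,β}(Pcl)`: both familywise error probabilities are controlled for all `A ∈ Pcl`. -/
def InDelta {K : ℕ} [MeasurableSpace Ω] (P : Finset (Fin K) → Measure Ω) (Pcl : Set (Finset (Fin K)))
    (α β : ℝ) (T : Ω → ℕ∞) (d : Ω → Finset (Fin K)) : Prop :=
  ∀ A ∈ Pcl, (P A {ω | ¬ d ω ⊆ A}).toReal ≤ α ∧ (P A {ω | ¬ A ⊆ d ω}).toReal ≤ β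

/-- `inf_{(T,d) ∈ Δ_{α,β}(Pcl)} E_A[T]`. -/
noncomputable def optESS {K : ℕ} [MeasurableSpace Ω] (P : Finset (Fin K) → Measure Ω)
    (F : ℕ → MeasurableSpace Ω) (Pcl : Set (Finset (Fin K))) (α β : ℝ)
    (A : Finset (Fin K)) : ℝ≥0∞ :=
  ⨅ (T : Ω → ℕ∞) (d : Ω → Finset (Fin K))
    (_ : IsST F T ∧ IsDecision F T d ∧ InDelta P Pcl α β T d),
      ∫⁻ ω, (T ω : ℝ≥0∞) ∂ P A

end SeqMT

namespace SeqMT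

lemma orderStat_eq {K : ℕ} (v : Fin K → ℝ) (m : ℕ) (hm1 : 1 ≤ m) (hmK : m ≤ K) :
    orderStat v m = (v ∘ Tuple.sort v) ⟨K - m, by omega⟩ := by
  have hmono : Monotone (v ∘ Tuple.sort v) := Tuple.monotone_sort v
  have h : (Finset.univ.val.map v).sort (· ≤ ·) = List.ofFn (v ∘ Tuple.sort v) := by
    apply List.Perm.eq_of_pairwise (le := (· ≤ ·))
    · intro a b _ _ h1 h2
      exact le_antisymm h1 h2
    · exact Multiset.pairwise_sort _ _
    · exact hmono.sortedLE_ofFn.pairwise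
    · rw [← Multiset.coe_eq_coe, Multiset.sort_eq]
      rw [List.ofFn_eq_map, ← Multiset.map_coe]
      have : ((List.finRange K : List (Fin K)) : Multiset (Fin K)) = Finset.univ.val := rfl
      rw [this, ← Multiset.map_map]
      congr 1
      have := congrArg Finset.val (Finset.map_univ_equiv (Tuple.sort v))
      simpa using this.symm
  unfold orderStat
  rw [h, List.getD_eq_getElem _ _ (by simp; omega)]
  simp

lemma le_orderStat_iff {K : ℕ} (v : Fin K → ℝ) (m : ℕ) (hm1 : 1 ≤ m) (hmK : m ≤ K) (x : ℝ) :
    x ≤ orderStat v m ↔ m ≤ (Finset.univ.filter fun k => x ≤ v k).card := by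
  rw [orderStat_eq v m hm1 hmK]
  have hmono : Monotone (v ∘ Tuple.sort v) := Tuple.monotone_sort v
  have hcard : (Finset.univ.filter fun k => x ≤ v k).card =
      (Finset.univ.filter fun k => x ≤ (v ∘ Tuple.sort v) k).card := by
    symm
    apply Finset.card_equiv (Tuple.sort v)
    intro i
    simp
  rw [hcard]
  generalize v ∘ Tuple.sort v = w at hmono
  constructor
  · intro h
    have hs : Finset.Ici (⟨K - m, by omega⟩ : Fin K) ⊆ Finset.univ.filter fun k => x ≤ w k := by
      intro i hi
      simp only [Finset.mem_filter, Finset.mem_univ, true_and]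
      exact h.trans (hmono (Finset.mem_Ici.1 hi))
    have := Finset.card_le_card hs
    rw [Fin.card_Ici] at this
    simp only at this
    omega
  · intro h
    by_contra hx
    push Not at hx
    have hs : (Finset.univ.filter fun k => x ≤ w k) ⊆ Finset.Ioi (⟨K - m, by omega⟩ : Fin K) := by
      intro i hi
      simp only [Finset.mem_filter, Finset.mem_univ, true_and] at hi
      rw [Finset.mem_Ioi]
      by_contra hc
      push Not at hc
      exact absurd (hi.trans (hmono hc)) (not_le.2 hx)
    have := Finset.card_le_card hs
    rw [Fin.card_Ioi] at this
    simp only at this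
    omega

/-- If the gap is positive and the top set is wrong, some pair is in the wrong order. -/
lemma exists_pair {K : ℕ} (v : Fin K → ℝ) (m : ℕ) (hm1 : 1 ≤ m) (hmK : m + 1 ≤ K)
    (c : ℝ) (hc : 0 < c) (A : Finset (Fin K)) (hA : A.card = m)
    (hgap : c ≤ orderStat v m - orderStat v (m + 1)) (hne : topSet v m ≠ A) :
    ∃ k ∈ A, ∃ j ∉ A, c ≤ v j - v k := by
  set S := Finset.univ.filter fun k => orderStat v m ≤ v k with hS
  have h1 : m ≤ S.card := (le_orderStat_iff v m hm1 (by omega) _).1 le_rfl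
  have h2 : ∀ x, orderStat v (m + 1) < x → (Finset.univ.filter fun k => x ≤ v k).card ≤ m := by
    intro x hx
    have := (le_orderStat_iff v (m + 1) (by omega) hmK x).not.1 (not_le.2 hx)
    omega
  have h3 : S.card = m := le_antisymm (h2 _ (by linarith)) h1
  have h4 : ∀ k, k ∉ S → v k ≤ orderStat v (m + 1) := by
    intro k hk
    by_contra hlt
    push Not at hlt
    have hsub : insert k S ⊆ Finset.univ.filter fun i => v k ≤ v i := by
      intro i hi
      rw [Finset.mem_insert] at hi
      simp only [hS, Finset.mem_filter, Finset.mem_univ, true_and] at hi hk ⊢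
      rcases hi with rfl | hi
      · exact le_rfl
      · linarith
    have := Finset.card_le_card hsub
    rw [Finset.card_insert_of_notMem hk] at this
    have := h2 _ hlt
    omega
  have hmem : ∀ k, k ∈ S ↔ orderStat v m ≤ v k := by intro k; simp [hS]
  have htop : topSet v m = S := by
    ext k
    have hiff : k ∈ topSet v m ↔ rankOf v k < m := by simp [topSet]
    rw [hiff]
    unfold rankOf
    constructor
    · intro h
      by_contra hk
      have hsub : S ⊆ Finset.univ.filter fun j => v k < v j ∨ (v j = v k ∧ j < k) := by
        intro j hj
        simp only [Finset.mem_filter, Finset.mem_univ, true_and]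
        left
        have := h4 k hk
        have := (hmem j).1 hj
        linarith
      have := Finset.card_le_card hsub
      omega
    · intro hk
      rw [← h3]
      apply Finset.card_lt_card
      rw [Finset.ssubset_iff_of_subset]
      · exact ⟨k, hk, by simp⟩
      · intro j hj
        simp only [Finset.mem_filter, Finset.mem_univ, true_and] at hj
        have := (hmem k).1 hk
        rw [hmem]
        rcases hj with hj | hj <;> linarith
  rw [htop] at hne
  have e1 : ∃ j ∈ S, j ∉ A := by
    by_contra h
    push Not at h
    exact hne (Finset.eq_of_subset_of_card_le h (by omega))
  have e2 : ∃ k ∈ A, k ∉ S := by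
    by_contra h
    push Not at h
    exact hne (Finset.eq_of_subset_of_card_le h (by omega)).symm
  obtain ⟨j, hj, hjA⟩ := e1
  obtain ⟨k, hkA, hk⟩ := e2
  refine ⟨k, hkA, j, hjA, ?_⟩
  have := h4 k hk
  have := (hmem j).1 hj
  linarith

lemma gap_of_sep {K : ℕ} (v : Fin K → ℝ) (m : ℕ) (hm1 : 1 ≤ m) (hmK : m + 1 ≤ K)
    (c : ℝ) (A : Finset (Fin K)) (hA : A.card = m)
    (h1 : ∀ k ∈ A, c ≤ v k) (h0 : ∀ k ∉ A, v k ≤ 0) :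
    c ≤ orderStat v m - orderStat v (m + 1) := by
  have a1 : c ≤ orderStat v m := by
    rw [le_orderStat_iff v m hm1 (by omega), ← hA]
    apply Finset.card_le_card
    intro k hk
    simpa using h1 k hk
  have a2 : orderStat v (m + 1) ≤ 0 := by
    by_contra h
    push Not at h
    have h5 := (le_orderStat_iff v (m + 1) (by omega) hmK _).1 le_rfl
    have : (Finset.univ.filter fun k => orderStat v (m + 1) ≤ v k) ⊆ A := by
      intro k hk
      simp only [Finset.mem_filter, Finset.mem_univ, true_and] at hk
      by_contra hkA
      have := h0 k hkA
      linarith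
    have := Finset.card_le_card this
    omega
  linarith

lemma stopTime_spec {Ω : Type*} (Q : ℕ → Ω → Prop) (ω : Ω) (h : stopTime Q ω < ⊤) :
    Q (stopTime Q ω).toNat ω := by
  have hne : {n : ℕ∞ | ∃ m : ℕ, n = (m : ℕ∞) ∧ 1 ≤ m ∧ Q m ω}.Nonempty := by
    by_contra hemp
    rw [Set.not_nonempty_iff_eq_empty] at hemp
    unfold stopTime at h
    rw [hemp, sInf_empty] at h
    exact lt_irrefl _ h
  obtain ⟨n, hn, -, hQ⟩ := csInf_mem hne
  have : stopTime Q ω = (n : ℕ∞) := hn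
  rw [this]
  simpa using hQ

lemma stopTime_lt_top {Ω : Type*} (Q : ℕ → Ω → Prop) (ω : Ω) (n : ℕ) (hn : 1 ≤ n) (h : Q n ω) :
    stopTime Q ω < ⊤ :=
  lt_of_le_of_lt (sInf_le ⟨n, rfl, hn, h⟩) (ENat.natCast_lt_top n)

lemma pair_bound
    {Ω : Type*} [MeasurableSpace Ω] {K : ℕ}
    (F : ℕ → MeasurableSpace Ω) (hFle : ∀ n, F n ≤ ‹MeasurableSpace Ω›)
    (hFmono : Monotone F)
    (P : Finset (Fin K) → Measure Ω) [∀ A : Finset (Fin K), IsProbabilityMeasure (P A)]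
    (lam : Fin K → ℕ → Ω → ℝ)
    (hadapt : ∀ (k : Fin K) (n : ℕ), Measurable[F n] fun ω => lam k n ω)
    (hLR : ∀ (A C : Finset (Fin K)) (n : ℕ) (Γ : Set Ω), MeasurableSet[F n] Γ →
      (P A Γ).toReal = ∫ ω in Γ, Real.exp (llrAC lam A C n ω) ∂ P C)
    (c : ℝ) (A : Finset (Fin K)) (k j : Fin K) (hk : k ∈ A) (hj : j ∉ A) :
    P A (⋃ n, {ω | c ≤ lam j n ω - lam k n ω}) ≤ ENNReal.ofReal (Real.exp (-c)) := by
  set B : ℕ → Set Ω := fun n => {ω | c ≤ lam j n ω - lam k n ω} with hB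
  have hkj : k ≠ j := fun h => hj (h ▸ hk)
  set C : Finset (Fin K) := insert j (A.erase k) with hC
  have hAC : A \ C = {k} := by
    ext i
    simp only [hC, Finset.mem_sdiff, Finset.mem_insert, Finset.mem_erase, Finset.mem_singleton]
    constructor
    · rintro ⟨h1, h2⟩
      by_contra h3
      exact h2 (Or.inr ⟨h3, h1⟩)
    · rintro rfl
      exact ⟨hk, by simp [hkj]⟩
  have hCA : C \ A = {j} := by
    ext i
    simp only [hC, Finset.mem_sdiff, Finset.mem_insert, Finset.mem_erase, Finset.mem_singleton]
    constructor
    · rintro ⟨h1 | h1, h2⟩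
      · exact h1
      · exact absurd h1.2 h2
    · rintro rfl
      exact ⟨Or.inl rfl, hj⟩
  have hllr : ∀ n ω, llrAC lam A C n ω = lam k n ω - lam j n ω := by
    intro n ω
    simp [llrAC, hAC, hCA]
  have hBm : ∀ n, MeasurableSet[F n] (B n) := by
    intro n
    have h : Measurable[F n] (fun ω => lam j n ω - lam k n ω) :=
      Measurable.sub (m := F n) (hadapt j n) (hadapt k n)
    exact h measurableSet_Ici
  have hDm : ∀ n, MeasurableSet[F n] (disjointed B n) := by
    intro n
    rw [disjointed_eq_inter_compl]
    refine @MeasurableSet.inter _ (F n) _ _ (hBm n) ?_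
    refine @MeasurableSet.iInter _ _ (F n) _ _ fun i => ?_
    refine @MeasurableSet.iInter _ _ (F n) _ _ fun hi => ?_
    exact @MeasurableSet.compl _ _ (F n) (hFmono hi.le _ (hBm i))
  have hint : ∀ n, Integrable (fun ω => Real.exp (llrAC lam A C n ω)) (P C) := by
    intro n
    by_contra hni
    have h1 := hLR A C n Set.univ (@MeasurableSet.univ _ (F n))
    rw [Measure.restrict_univ, integral_undef hni] at h1
    simp at h1
  have hD : ∀ n, P A (disjointed B n) ≤ ENNReal.ofReal (Real.exp (-c)) * P C (disjointed B n) := by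
    intro n
    have hm : MeasurableSet (disjointed B n) := hFle n _ (hDm n)
    have h1 : (P A (disjointed B n)).toReal ≤ Real.exp (-c) * (P C (disjointed B n)).toReal := by
      rw [hLR A C n _ (hDm n)]
      calc ∫ ω in disjointed B n, Real.exp (llrAC lam A C n ω) ∂ P C
          ≤ ∫ ω in disjointed B n, Real.exp (-c) ∂ P C := by
            refine setIntegral_mono_on (hint n).integrableOn (integrable_const _).integrableOn hm ?_
            intro ω hω
            have : c ≤ lam j n ω - lam k n ω := disjointed_le B n hω
            rw [hllr]
            exact Real.exp_le_exp.2 (by linarith)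
        _ = _ := by
            rw [setIntegral_const, smul_eq_mul, mul_comm]
            rfl
    rw [← ENNReal.ofReal_toReal (measure_ne_top (P A) (disjointed B n)),
      ← ENNReal.ofReal_toReal (measure_ne_top (P C) (disjointed B n)),
      ← ENNReal.ofReal_mul (Real.exp_pos _).le]
    exact ENNReal.ofReal_le_ofReal h1
  rw [← iUnion_disjointed]
  calc P A (⋃ n, disjointed B n) ≤ ∑' n, P A (disjointed B n) := measure_iUnion_le _
    _ ≤ ∑' n, ENNReal.ofReal (Real.exp (-c)) * P C (disjointed B n) := ENNReal.tsum_le_tsum hD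
    _ = ENNReal.ofReal (Real.exp (-c)) * P C (⋃ n, disjointed B n) := by
        rw [ENNReal.tsum_mul_left, measure_iUnion (disjoint_disjointed B)
          (fun n => hFle n _ (hDm n))]
    _ ≤ ENNReal.ofReal (Real.exp (-c)) * 1 := by gcongr; exact prob_le_one
    _ = _ := mul_one _

/-- **Theorem 3.1 (error control of the gap rule).**
Fix `m ∈ {1,…,K-1}`, a threshold `c > 0` and `A ⊆ [K]` with `|A| = m`.  Under the
likelihood-ratio structure (`hLR`) and the singularity assumption (`hdiv1`, `hdiv0`),
the gap rule stopping time is `P_A`-a.s. finite and `P_A(d_G ≠ A) ≤ m(K-m)e^{-c}`. -/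
theorem gap_rule_error_control
    {Ω : Type*} [MeasurableSpace Ω] {K : ℕ}
    (F : ℕ → MeasurableSpace Ω) (hFle : ∀ n, F n ≤ ‹MeasurableSpace Ω›)
    (hFmono : Monotone F)
    (P : Finset (Fin K) → Measure Ω) [∀ A : Finset (Fin K), IsProbabilityMeasure (P A)]
    (lam : Fin K → ℕ → Ω → ℝ)
    (hadapt : ∀ (k : Fin K) (n : ℕ), Measurable[F n] fun ω => lam k n ω)
    (hLR : ∀ (A C : Finset (Fin K)) (n : ℕ) (Γ : Set Ω), MeasurableSet[F n] Γ →
      (P A Γ).toReal = ∫ ω in Γ, Real.exp (llrAC lam A C n ω) ∂ P C)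
    (hdiv1 : ∀ (A : Finset (Fin K)) (k : Fin K), k ∈ A →
      ∀ᵐ ω ∂ P A, Tendsto (fun n => lam k n ω) atTop atTop)
    (hdiv0 : ∀ (A : Finset (Fin K)) (k : Fin K), k ∉ A →
      ∀ᵐ ω ∂ P A, Tendsto (fun n => lam k n ω) atTop atBot)
    (m : ℕ) (hm1 : 1 ≤ m) (hmK : m ≤ K - 1)
    (c : ℝ) (hc : 0 < c)
    (A : Finset (Fin K)) (hA : A.card = m) :
    P A {ω | gapTime lam m c ω < ⊤} = 1 ∧
    (P A {ω | gapDecision lam m c ω ≠ A}).toReal ≤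
      (m : ℝ) * ((K : ℝ) - m) * Real.exp (-c) := by
  have hmK' : m + 1 ≤ K := by omega
  have hfin : ∀ᵐ ω ∂ P A, gapTime lam m c ω < ⊤ := by
    have h1 : ∀ᵐ ω ∂ P A, ∀ k, k ∈ A → Tendsto (fun n => lam k n ω) atTop atTop := by
      rw [ae_all_iff]
      intro k
      by_cases hk : k ∈ A
      · filter_upwards [hdiv1 A k hk] with ω hω _ using hω
      · exact ae_of_all _ fun ω h => absurd h hk
    have h0 : ∀ᵐ ω ∂ P A, ∀ k, k ∉ A → Tendsto (fun n => lam k n ω) atTop atBot := by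
      rw [ae_all_iff]
      intro k
      by_cases hk : k ∈ A
      · exact ae_of_all _ fun ω h => absurd hk h
      · filter_upwards [hdiv0 A k hk] with ω hω _ using hω
    filter_upwards [h1, h0] with ω h1 h0
    have e1 : ∀ᶠ n in atTop, ∀ k, k ∈ A → c ≤ lam k n ω := by
      rw [eventually_all]
      intro k
      by_cases hk : k ∈ A
      · filter_upwards [(h1 k hk).eventually_ge_atTop c] with n hn _ using hn
      · exact Eventually.of_forall fun n h => absurd h hk
    have e0 : ∀ᶠ n in atTop, ∀ k, k ∉ A → lam k n ω ≤ 0 := by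
      rw [eventually_all]
      intro k
      by_cases hk : k ∈ A
      · exact Eventually.of_forall fun n h => absurd hk h
      · filter_upwards [(h0 k hk).eventually_le_atBot 0] with n hn _ using hn
    obtain ⟨n, ⟨g1, g0⟩, hn⟩ := ((e1.and e0).and (eventually_ge_atTop 1)).exists
    exact stopTime_lt_top _ ω n hn (gap_of_sep (fun k => lam k n ω) m hm1 hmK' c A hA g1 g0)
  refine ⟨?_, ?_⟩
  · rw [measure_congr (eventuallyEq_univ.2 hfin)]
    exact measure_univ
  have hsub : ∀ᵐ ω ∂ P A, gapDecision lam m c ω ≠ A →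
      ω ∈ ⋃ p ∈ A ×ˢ Aᶜ, ⋃ n, {ω | c ≤ lam p.2 n ω - lam p.1 n ω} := by
    filter_upwards [hfin] with ω hω hne
    obtain ⟨k, hk, j, hj, hkj⟩ := exists_pair (fun k => lam k (gapTime lam m c ω).toNat ω) m hm1
      hmK' c hc A hA (stopTime_spec _ ω hω) hne
    simp only [Set.mem_iUnion]
    exact ⟨(k, j), by simp [hk, hj], _, hkj⟩
  have hb : P A {ω | gapDecision lam m c ω ≠ A} ≤
      ENNReal.ofReal ((m : ℝ) * ((K : ℝ) - m) * Real.exp (-c)) := by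
    calc P A {ω | gapDecision lam m c ω ≠ A}
        ≤ P A (⋃ p ∈ A ×ˢ Aᶜ, ⋃ n, {ω | c ≤ lam p.2 n ω - lam p.1 n ω}) := measure_mono_ae hsub
      _ ≤ ∑ p ∈ A ×ˢ Aᶜ, P A (⋃ n, {ω | c ≤ lam p.2 n ω - lam p.1 n ω}) :=
          measure_biUnion_finset_le _ _
      _ ≤ ∑ p ∈ A ×ˢ Aᶜ, ENNReal.ofReal (Real.exp (-c)) := by
          refine Finset.sum_le_sum fun p hp => ?_
          rw [Finset.mem_product, Finset.mem_compl] at hp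
          exact pair_bound F hFle hFmono P lam hadapt hLR c A p.1 p.2 hp.1 hp.2
      _ = _ := by
          rw [Finset.sum_const, Finset.card_product, Finset.card_compl, Fintype.card_fin, hA,
            nsmul_eq_mul, ← ENNReal.ofReal_natCast, ← ENNReal.ofReal_mul (by positivity)]
          rw [Nat.cast_mul, Nat.cast_sub (by omega)]
  refine ENNReal.toReal_le_of_le_ofReal ?_ hb
  have : (m : ℝ) ≤ K := by exact_mod_cast (by omega : m ≤ K)
  have : (0 : ℝ) ≤ (K : ℝ) - m := by linarith
  positivity

end SeqMT
end
end

section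
/- Let Q and P be equivalent (mutually absolutely continuous) probability measures on a measurable space (Ω, G), and let A ∈ G be an event with Q(A) ∈ (0,1) and P(A^c) ∈ (0,1). Then the Kullback–Leibler divergence satisfies E_Q[log(dQ/dP)] ≥ φ(Q(A), P(A^c)), where φ(x,y) := x log(x/(1−y)) + (1−x) log((1−x)/y). -/
open MeasureTheory ProbabilityTheory Filter Set
open scoped ENNReal NNReal Topology Classical

noncomputable section

namespace SeqMT

/-- Log-sum inequality on a measurable set. -/
lemma set_log_sum {Ω : Type*} [MeasurableSpace Ω]
    (Q P : Measure Ω) [IsProbabilityMeasure Q] [IsProbabilityMeasure P]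
    (hQP : Q ≪ P) (hint : Integrable (llr Q P) Q) (B : Set Ω) (hB : MeasurableSet B) :
    Q.real B * Real.log (Q.real B / P.real B) ≤ ∫ ω in B, llr Q P ω ∂Q := by
  have hac : Q.restrict B ≪ P.restrict B := hQP.restrict B
  have h1 : Q.restrict B = (P.restrict B).withDensity (Q.rnDeriv P) := by
    rw [← restrict_withDensity hB, Measure.withDensity_rnDeriv_eq _ _ hQP]
  have h2 : (Q.restrict B).rnDeriv (P.restrict B) =ᵐ[P.restrict B] Q.rnDeriv P := by
    conv_lhs => rw [h1]
    exact Measure.rnDeriv_withDensity _ (Measure.measurable_rnDeriv _ _)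
  have h3 : llr (Q.restrict B) (P.restrict B) =ᵐ[Q.restrict B] llr Q P := by
    filter_upwards [hac.ae_le h2] with x hx
    simp only [llr, hx]
  have hi : Integrable (llr (Q.restrict B) (P.restrict B)) (Q.restrict B) :=
    hint.restrict.congr h3.symm
  have h4 := InformationTheory.mul_log_le_toReal_klDiv hac hi
  rw [InformationTheory.toReal_klDiv hac hi, integral_congr_ae h3] at h4
  simp only [measureReal_restrict_apply_univ] at h4
  linarith

/-- **Lemma A.1 (information-theoretic inequality).**  Let `Q` and `P` be equivalent probability
measures on `(Ω, G)` and `A` an event with `Q(A) ∈ (0,1)` and `P(Aᶜ) ∈ (0,1)`.  Then the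
Kullback–Leibler divergence `E_Q[log(dQ/dP)]` (the integral of the log-likelihood ratio
`llr Q P`, assumed to exist) is at least `φ(Q(A), P(Aᶜ))`. -/
theorem kl_information_inequality
    {Ω : Type*} [MeasurableSpace Ω]
    (Q P : Measure Ω) [IsProbabilityMeasure Q] [IsProbabilityMeasure P]
    (hQP : Q ≪ P) (hPQ : P ≪ Q)
    (hint : Integrable (llr Q P) Q)
    (A : Set Ω) (hA : MeasurableSet A)
    (hQA : Q A ∈ Set.Ioo (0 : ℝ≥0∞) 1) (hPA : P Aᶜ ∈ Set.Ioo (0 : ℝ≥0∞) 1) :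
    phi (Q A).toReal (P Aᶜ).toReal ≤ ∫ ω, llr Q P ω ∂ Q := by
  have hA1 := set_log_sum Q P hQP hint A hA
  have hA2 := set_log_sum Q P hQP hint Aᶜ hA.compl
  have e := integral_add_compl hA hint
  have q : Q.real Aᶜ = 1 - Q.real A := probReal_compl_eq_one_sub hA
  have p : P.real A = 1 - P.real Aᶜ := by
    rw [probReal_compl_eq_one_sub hA]; ring
  rw [p] at hA1
  rw [q] at hA2
  unfold phi
  simp only [measureReal_def] at hA1 hA2
  linarith

end SeqMT
end
end

section
/- The function φ(x,y) := x log(x/(1−y)) + (1−x) log((1−x)/y) is decreasing on the region {(x,y) ∈ (0,1)² : x + y ≤ 1}: if (x,y) and (x',y') lie in this region with x ≤ x' and y ≤ y', then φ(x,y) ≥ φ(x',y'). -/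
open MeasureTheory ProbabilityTheory Filter Set
open scoped ENNReal NNReal Topology Classical

noncomputable section

namespace SeqMT

/-- Tangent-line bound: `a (log b - log a) ≤ b - a`. -/
theorem mul_log_sub_le (a b : ℝ) (ha : 0 < a) (hb : 0 < b) :
    a * (Real.log b - Real.log a) ≤ b - a := by
  rw [← Real.log_div hb.ne' ha.ne']
  have h := Real.log_le_sub_one_of_pos (div_pos hb ha)
  have h2 := mul_le_mul_of_nonneg_left h ha.le
  have h3 : a * (b / a - 1) = b - a := by field_simp
  linarith

/-- **`φ` is decreasing on `{(x,y) ∈ (0,1)² : x + y ≤ 1}`**: if `(x,y)` and `(x',y')` lie in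
this region with `x ≤ x'` and `y ≤ y'`, then `φ(x,y) ≥ φ(x',y')`. -/
theorem phi_antitone
    (x y x' y' : ℝ)
    (hx : x ∈ Set.Ioo (0:ℝ) 1) (hy : y ∈ Set.Ioo (0:ℝ) 1)
    (hx' : x' ∈ Set.Ioo (0:ℝ) 1) (hy' : y' ∈ Set.Ioo (0:ℝ) 1)
    (hxy : x + y ≤ 1) (hxy' : x' + y' ≤ 1)
    (hxx : x ≤ x') (hyy : y ≤ y') :
    phi x' y' ≤ phi x y := by
  obtain ⟨hx0, hx1⟩ := hx
  obtain ⟨hy0, hy1⟩ := hy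
  obtain ⟨hx0', hx1'⟩ := hx'
  obtain ⟨hy0', hy1'⟩ := hy'
  have a1 : 0 < 1 - x := by linarith
  have a2 : 0 < 1 - y := by linarith
  have a3 : 0 < 1 - x' := by linarith
  have a4 : 0 < 1 - y' := by linarith
  unfold phi
  rw [Real.log_div hx0.ne' a2.ne', Real.log_div a1.ne' hy0.ne',
    Real.log_div hx0'.ne' a4.ne', Real.log_div a3.ne' hy0'.ne']
  have k1 := mul_log_sub_le x x' hx0 hx0'
  have k2 := mul_log_sub_le (1 - x) (1 - x') a1 a3
  have k3 := mul_log_sub_le (1 - y') (1 - y) a4 a2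
  have k4 := mul_log_sub_le y' y hy0' hy0
  have l1 : Real.log x' ≤ Real.log (1 - y) := Real.log_le_log hx0' (by linarith)
  have l2 : Real.log y ≤ Real.log (1 - x') := Real.log_le_log hy0 (by linarith)
  have l3 : Real.log (1 - y') ≤ Real.log (1 - y) := Real.log_le_log a4 (by linarith)
  have l4 : Real.log y ≤ Real.log y' := Real.log_le_log hy0 hyy
  have m1 := mul_nonneg (sub_nonneg.2 hxx) (add_nonneg (sub_nonneg.2 l1) (sub_nonneg.2 l2))
  have m2 := mul_nonneg (sub_nonneg.2 hxy') (add_nonneg (sub_nonneg.2 l3) (sub_nonneg.2 l4))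
  linarith

end SeqMT
end
end
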